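/- For every element λ of the root lattice Q one has ht(λ_+) − ht(λ) = Σ_{α ∈ Π(w_λ)} (λ_+, α^∨). Moreover, for every α ∈ Π(w_λ) one has (λ_+, α^∨) ≥ 1, and consequently the integer D_λ := ht(λ_+) − ht(λ) − ℓ(w_λ) = Σ_{α ∈ Π(w_λ)} ((λ_+, α^∨) − 1) is nonnegative. -/

import Mathlib

open scoped RealInnerProductSpace

attribute [local instance] Classical.propDecidable

noncomputable section

/-- The reflection in the hyperplane orthogonal to `α`. -/
def sref {V : Type*} [NormedAddCommGroup V] [InnerProductSpace ℝ V] (α x : V) : V :=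
  x - (2 * ⟪x, α⟫ / ⟪α, α⟫) • α

/-- The coroot `α^∨ = 2α/(α,α)`. -/
def coroot {V : Type*} [NormedAddCommGroup V] [InnerProductSpace ℝ V] (α : V) : V :=
  (2 / ⟪α, α⟫) • α

/-- The data of a finite reduced irreducible crystallographic root system `R` in a real
inner product space, together with a fixed choice of positive roots and simple roots. -/
structure RSD (V : Type*) [NormedAddCommGroup V] [InnerProductSpace ℝ V] where
  R : Finset V
  Rpos : Finset V
  n : ℕ
  npos : 0 < n
  simple : Fin n → V
  simple_mem : ∀ i, simple i ∈ Rpos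
  pos_sub : Rpos ⊆ R
  root_ne_zero : ∀ α ∈ R, α ≠ 0
  pos_or_neg : ∀ α ∈ R, α ∈ Rpos ∨ -α ∈ Rpos
  not_both : ∀ α ∈ Rpos, -α ∉ Rpos
  pos_combo : ∀ α ∈ Rpos, ∃ c : Fin n → ℕ, α = ∑ i, (c i : ℝ) • simple i
  simple_indep : LinearIndependent ℝ simple
  reduced : ∀ α ∈ R, ∀ c : ℝ, c • α ∈ R → c = 1 ∨ c = -1
  crystal : ∀ α ∈ R, ∀ β ∈ R, ∃ k : ℤ, ⟪β, coroot α⟫ = (k : ℝ)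
  refl_mem : ∀ α ∈ R, ∀ β ∈ R, sref α β ∈ R
  spanning : Submodule.span ℝ (R : Set V) = ⊤
  irred : ∀ s : Set V, (∀ α ∈ R, ∀ β ∈ R, α ∈ s → β ∉ s → ⟪α, β⟫ = 0) →
    (∀ α ∈ R, α ∈ s) ∨ (∀ α ∈ R, α ∉ s)

namespace RSD

variable {V : Type*} [NormedAddCommGroup V] [InnerProductSpace ℝ V]

/-- The map of `V` determined by a word in the simple reflections. -/
def wordMap (S : RSD V) (l : List (Fin S.n)) : V → V :=
  l.foldr (fun i f => sref (S.simple i) ∘ f) id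

/-- `w : V → V` is an element of the Weyl group `W`, i.e. a product of simple reflections. -/
def IsWeyl (S : RSD V) (w : V → V) : Prop := ∃ l : List (Fin S.n), w = S.wordMap l

/-- The length `ℓ(w)` of a Weyl group element: the smallest length of a word in the simple
reflections representing `w`. -/
def len (S : RSD V) (w : V → V) : ℕ :=
  sInf {k | ∃ l : List (Fin S.n), l.length = k ∧ w = S.wordMap l}

/-- `x` and `y` lie in the same Weyl group orbit. -/
def sameOrbit (S : RSD V) (x y : V) : Prop := ∃ w, S.IsWeyl w ∧ w x = y

/-- `x` is dominant: `(x, α_i) ≥ 0` for all simple roots. -/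
def Dominant (S : RSD V) (x : V) : Prop := ∀ i, 0 ≤ ⟪x, S.simple i⟫

/-- `w` is a Weyl group element of minimal length among those sending `x` to `y`. -/
def IsMinWord (S : RSD V) (x y : V) (w : V → V) : Prop :=
  S.IsWeyl w ∧ w x = y ∧ ∀ w' : V → V, S.IsWeyl w' → w' x = y → S.len w ≤ S.len w'

/-- Membership in the root lattice `Q`, the ℤ-span of the simple roots. -/
def inQ (S : RSD V) (x : V) : Prop :=
  ∃ c : Fin S.n → ℤ, x = ∑ i, (c i : ℝ) • S.simple i

/-- The height `ht(λ) = Σ a_i` of an element `λ = Σ a_i α_i` of the root lattice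
(the coefficients are unique since the simple roots are linearly independent). -/
def htZ (S : RSD V) (x : V) : ℤ :=
  if h : ∃ c : Fin S.n → ℤ, x = ∑ i, (c i : ℝ) • S.simple i then ∑ i, h.choose i else 0

/-- The inversion set `Π(w) = {α ∈ R⁺ : w(α) ∈ R⁻}`. -/
def PiSet (S : RSD V) (w : V → V) : Finset V :=
  S.Rpos.filter (fun α => -(w α) ∈ S.Rpos)

/-- `α` is a short root (if all roots have the same length, all roots are short). -/
def IsShort (S : RSD V) (α : V) : Prop :=
  α ∈ S.R ∧ ∀ β ∈ S.R, ⟪α, α⟫ ≤ ⟪β, β⟫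

/-- `α` is a long root. -/
def IsLong (S : RSD V) (α : V) : Prop :=
  α ∈ S.R ∧ ∀ β ∈ S.R, ⟪β, β⟫ ≤ ⟪α, α⟫

/-- The short roots in the inversion set `Π(w)`. -/
def PiS (S : RSD V) (w : V → V) : Finset V :=
  (S.PiSet w).filter (fun α => S.IsShort α)

/-- The long roots in the inversion set `Π(w)`. -/
def PiL (S : RSD V) (w : V → V) : Finset V :=
  (S.PiSet w).filter (fun α => S.IsLong α)

end RSD


section Reflections

variable {V : Type*} [NormedAddCommGroup V] [InnerProductSpace ℝ V]

/-- The reflection `sref α` as a linear isometric equivalence. -/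
def srefEquiv (α : V) : V ≃ₗᵢ[ℝ] V := (ℝ ∙ α)ᗮ.reflection

lemma coe_srefEquiv (α : V) : ⇑(srefEquiv α) = sref α := by
  ext x
  rw [srefEquiv, Submodule.reflection_orthogonal_apply, Submodule.reflection_singleton_apply,
    sref, real_inner_comm, real_inner_self_eq_norm_sq, neg_sub, ← Nat.cast_smul_eq_nsmul ℝ,
    smul_smul, mul_div_assoc]
  norm_num

lemma srefEquiv_symm (α : V) : (srefEquiv α).symm = srefEquiv α :=
  Submodule.reflection_symm

lemma sref_sref (α x : V) : sref α (sref α x) = x := by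
  simp only [← coe_srefEquiv]
  exact Submodule.reflection_reflection _ x

lemma sref_neg_right (α x : V) : sref α (-x) = -sref α x := by
  rw [← coe_srefEquiv, map_neg]

lemma sref_eq_sub_coroot (α x : V) : sref α x = x - ⟪x, coroot α⟫ • α := by
  rw [sref, coroot, inner_smul_right]
  congr 2
  ring

lemma sref_self {α : V} (hα : α ≠ 0) : sref α α = -α := by
  have : ⟪α, α⟫ ≠ 0 := inner_self_ne_zero.mpr hα
  rw [sref, mul_div_assoc, div_self this]
  module

lemma coroot_neg (α : V) : coroot (-α) = -coroot α := by
  simp [coroot]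

lemma map_sref (f : V ≃ₗᵢ[ℝ] V) (α x : V) : f (sref α x) = sref (f α) (f x) := by
  simp [sref]

lemma inner_map_coroot_map (f : V ≃ₗᵢ[ℝ] V) (α x : V) :
    ⟪f x, coroot (f α)⟫ = ⟪x, coroot α⟫ := by
  simp [coroot, inner_smul_right]

end Reflections

namespace RSD

variable {V : Type*} [NormedAddCommGroup V] [InnerProductSpace ℝ V] (S : RSD V)

lemma simple_mem_R (i : Fin S.n) : S.simple i ∈ S.R := S.pos_sub (S.simple_mem i)

lemma coeff_ext {c d : Fin S.n → ℝ}
    (h : ∑ i, c i • S.simple i = ∑ i, d i • S.simple i) : c = d := by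
  ext i
  refine sub_eq_zero.mp (Fintype.linearIndependent_iff.mp S.simple_indep (c - d) ?_ i)
  simp [sub_smul, Finset.sum_sub_distrib, h]

lemma htZ_sum (c : Fin S.n → ℤ) : S.htZ (∑ i, (c i : ℝ) • S.simple i) = ∑ i, c i := by
  have h : ∃ d : Fin S.n → ℤ,
      ∑ i, (c i : ℝ) • S.simple i = ∑ i, (d i : ℝ) • S.simple i := ⟨c, rfl⟩
  rw [htZ, dif_pos h]
  refine Finset.sum_congr rfl fun i _ => ?_
  exact_mod_cast (congrFun (S.coeff_ext h.choose_spec) i).symm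

variable {S}

lemma inQ.exists_inner_coroot_eq {x : V} (hx : S.inQ x) {α : V} (hα : α ∈ S.R) :
    ∃ k : ℤ, ⟪x, coroot α⟫ = k := by
  obtain ⟨c, rfl⟩ := hx
  choose k hk using fun i => S.crystal α hα (S.simple i) (S.simple_mem_R i)
  exact ⟨∑ i, c i * k i, by simp [sum_inner, inner_smul_left, hk]⟩

lemma inQ.sref_simple {x : V} (hx : S.inQ x) (i : Fin S.n) :
    S.inQ (sref (S.simple i) x) ∧
      (S.htZ (sref (S.simple i) x) : ℝ) = S.htZ x - ⟪x, coroot (S.simple i)⟫ := by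
  obtain ⟨k, hk⟩ := hx.exists_inner_coroot_eq (S.simple_mem_R i)
  obtain ⟨c, rfl⟩ := hx
  have key : sref (S.simple i) (∑ j, (c j : ℝ) • S.simple j) =
      ∑ j, ((c j - Pi.single (M := fun _ => ℤ) i k j : ℤ) : ℝ) • S.simple j := by
    rw [sref_eq_sub_coroot, hk]
    simp [sub_smul, Finset.sum_sub_distrib, Pi.single_apply, ite_smul]
  refine ⟨⟨_, key⟩, ?_⟩
  rw [hk, key, htZ_sum, htZ_sum]
  simp [Finset.sum_sub_distrib]

/-- A simple reflection permutes the positive roots other than its own simple root. -/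
lemma sref_simple_mem_Rpos {β : V} (hβ : β ∈ S.Rpos) {i : Fin S.n} (hne : β ≠ S.simple i) :
    sref (S.simple i) β ∈ S.Rpos := by
  refine (S.pos_or_neg _ (S.refl_mem _ (S.simple_mem_R i) _ (S.pos_sub hβ))).resolve_right ?_
  intro hneg
  obtain ⟨c, hc⟩ := S.pos_combo β hβ
  obtain ⟨d, hd⟩ := S.pos_combo _ hneg
  set k := ⟪β, coroot (S.simple i)⟫ with hk
  have hsum : ∑ j, ((c j : ℝ) + d j) • S.simple j =
      ∑ j, (Pi.single (M := fun _ => ℝ) i k j) • S.simple j := by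
    simp only [add_smul, Finset.sum_add_distrib, ← hc, ← hd, sref_eq_sub_coroot]
    simp [Pi.single_apply, ite_smul, ← hk]
  have hzero : ∀ j, j ≠ i → (c j : ℝ) = 0 := fun j hj => by
    have := congrFun (S.coeff_ext hsum) j
    rw [Pi.single_eq_of_ne hj] at this
    linarith [(c j).cast_nonneg (α := ℝ), (d j).cast_nonneg (α := ℝ)]
  have hβi : β = (c i : ℝ) • S.simple i := by
    rw [hc]
    exact Finset.sum_eq_single i (fun j _ hj => by rw [hzero j hj, zero_smul]) (by simp)
  rcases S.reduced _ (S.simple_mem_R i) (c i) (hβi ▸ S.pos_sub hβ) with h | h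
  · exact hne (by rw [hβi, h, one_smul])
  · linarith [(c i).cast_nonneg (α := ℝ)]

lemma Dominant.inner_coroot_nonneg {x : V} (hx : S.Dominant x) {α : V} (hα : α ∈ S.Rpos) :
    0 ≤ ⟪x, coroot α⟫ := by
  have hinner : 0 ≤ ⟪x, α⟫ := by
    obtain ⟨c, rfl⟩ := S.pos_combo α hα
    rw [inner_sum]
    refine Finset.sum_nonneg fun i _ => ?_
    rw [inner_smul_right]
    exact mul_nonneg (c i).cast_nonneg (hx i)
  rw [coroot, inner_smul_right]
  exact mul_nonneg (div_nonneg zero_le_two real_inner_self_nonneg) hinner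

variable (S)

/-- The map determined by a word in the simple reflections, as a linear isometric equivalence. -/
def wordEquiv : List (Fin S.n) → V ≃ₗᵢ[ℝ] V
  | [] => .refl ℝ V
  | i :: l => (wordEquiv l).trans (srefEquiv (S.simple i))

lemma wordMap_cons (i : Fin S.n) (l : List (Fin S.n)) (x : V) :
    S.wordMap (i :: l) x = sref (S.simple i) (S.wordMap l x) := rfl

lemma coe_wordEquiv (l : List (Fin S.n)) : ⇑(S.wordEquiv l) = S.wordMap l := by
  induction l with
  | nil => rfl
  | cons i l ih =>
    ext x
    rw [wordMap_cons, ← ih, ← coe_srefEquiv]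
    rfl

lemma wordEquiv_symm_mem_R (l : List (Fin S.n)) {α : V} (hα : α ∈ S.R) :
    (S.wordEquiv l).symm α ∈ S.R := by
  induction l generalizing α with
  | nil => exact hα
  | cons i l ih =>
    have := ih (S.refl_mem _ (S.simple_mem_R i) _ hα)
    rwa [← coe_srefEquiv, ← srefEquiv_symm] at this

lemma exists_wordMap_eq_simple (l : List (Fin S.n)) (i : Fin S.n) :
    ∃ γ ∈ S.R, S.wordMap l γ = S.simple i :=
  ⟨_, S.wordEquiv_symm_mem_R l (S.simple_mem_R i), by simp [← coe_wordEquiv]⟩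

lemma wordMap_neg (l : List (Fin S.n)) (x : V) : S.wordMap l (-x) = -S.wordMap l x := by
  rw [← coe_wordEquiv, map_neg]

variable {S}

/-- The exchange condition: composing with the reflection in an inverted root deletes a letter. -/
lemma exists_word_sref_comp {l : List (Fin S.n)} {α β : V} (hα : α ∈ S.Rpos) (hβ : β ∈ S.Rpos)
    (h : S.wordMap l α = -β) :
    ∃ l' : List (Fin S.n), l'.length + 1 = l.length ∧
      ∀ x, S.wordMap l' x = sref β (S.wordMap l x) := by
  induction l generalizing β with
  | nil =>
    obtain rfl : α = -β := h
    exact absurd hα (S.not_both β hβ)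
  | cons i l ih =>
    by_cases hne : β = S.simple i
    · exact ⟨l, rfl, fun x => by rw [wordMap_cons, hne, sref_sref]⟩
    · have h' : S.wordMap l α = -sref (S.simple i) β := by
        rw [← sref_neg_right, ← h, wordMap_cons, sref_sref]
      obtain ⟨l', hl', hmap⟩ := ih (sref_simple_mem_Rpos hβ hne) h'
      refine ⟨i :: l', by simp [hl'], fun x => ?_⟩
      rw [wordMap_cons, wordMap_cons, hmap, ← coe_srefEquiv (S.simple i), map_sref,
        coe_srefEquiv, sref_sref]

lemma mem_PiSet {w : V → V} {α : V} : α ∈ S.PiSet w ↔ α ∈ S.Rpos ∧ -(w α) ∈ S.Rpos :=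
  Finset.mem_filter

lemma neg_wordMap_cons_mem_iff {l : List (Fin S.n)} {i : Fin S.n} {γ α : V}
    (hγ : S.wordMap l γ = S.simple i) (hα : α ≠ γ) (hα' : α ≠ -γ) :
    -(S.wordMap (i :: l) α) ∈ S.Rpos ↔ -(S.wordMap l α) ∈ S.Rpos := by
  have hinj : Function.Injective (S.wordMap l) :=
    S.coe_wordEquiv l ▸ (S.wordEquiv l).injective
  have h₁ : -(S.wordMap l α) ≠ S.simple i := fun h => hα' (hinj (by
    rw [wordMap_neg, hγ, ← h, neg_neg]))
  have h₂ : -(S.wordMap (i :: l) α) ≠ S.simple i := fun h => hα (hinj (by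
    rw [hγ, ← sref_sref (S.simple i) (S.wordMap l α), ← wordMap_cons,
      ← neg_neg (S.wordMap (i :: l) α), h, sref_neg_right,
      sref_self (S.root_ne_zero _ (S.simple_mem_R i)), neg_neg]))
  constructor <;> intro h
  · simpa [wordMap_cons, sref_neg_right, sref_sref] using sref_simple_mem_Rpos h h₂
  · simpa [wordMap_cons, sref_neg_right] using sref_simple_mem_Rpos h h₁

lemma neg_wordMap_cons_of_eq_simple {l : List (Fin S.n)} {i : Fin S.n} {γ : V}
    (hγ : S.wordMap l γ = S.simple i) : -(S.wordMap (i :: l) γ) = S.simple i := by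
  rw [wordMap_cons, hγ, sref_self (S.root_ne_zero _ (S.simple_mem_R i)), neg_neg]

lemma PiSet_cons_of_pos {l : List (Fin S.n)} {i : Fin S.n} {γ : V}
    (hγ : S.wordMap l γ = S.simple i) (hpos : γ ∈ S.Rpos) :
    γ ∉ S.PiSet (S.wordMap l) ∧
      S.PiSet (S.wordMap (i :: l)) = insert γ (S.PiSet (S.wordMap l)) := by
  refine ⟨fun h => S.not_both _ (S.simple_mem i) (hγ ▸ (mem_PiSet.mp h).2), ?_⟩
  ext α
  rw [Finset.mem_insert, mem_PiSet, mem_PiSet]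
  by_cases hα : α = γ
  · subst hα
    simp [hpos, neg_wordMap_cons_of_eq_simple hγ, S.simple_mem i]
  · simp only [hα, false_or]
    refine and_congr_right fun hmem => neg_wordMap_cons_mem_iff hγ hα ?_
    rintro rfl
    exact S.not_both _ hpos hmem

lemma PiSet_cons_of_neg {l : List (Fin S.n)} {i : Fin S.n} {γ : V}
    (hγ : S.wordMap l γ = S.simple i) (hneg : -γ ∈ S.Rpos) :
    -γ ∉ S.PiSet (S.wordMap (i :: l)) ∧
      S.PiSet (S.wordMap l) = insert (-γ) (S.PiSet (S.wordMap (i :: l))) := by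
  have hγ' := neg_wordMap_cons_of_eq_simple hγ
  constructor
  · intro h
    have h' := (mem_PiSet.mp h).2
    rw [wordMap_neg, hγ'] at h'
    exact S.not_both _ (S.simple_mem i) h'
  ext α
  rw [Finset.mem_insert, mem_PiSet, mem_PiSet]
  by_cases hα : α = -γ
  · subst hα
    simp [hneg, wordMap_neg, hγ, S.simple_mem i]
  · simp only [hα, false_or]
    refine and_congr_right fun hmem => (neg_wordMap_cons_mem_iff hγ ?_ hα).symm
    rintro rfl
    exact S.not_both _ hmem hneg

/-- Height drop along any Weyl group element, as a sum over its inversion set. -/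
lemma inQ.wordMap {x : V} (hx : S.inQ x) (l : List (Fin S.n)) :
    S.inQ (S.wordMap l x) ∧
      (S.htZ x : ℝ) - S.htZ (S.wordMap l x) = ∑ α ∈ S.PiSet (S.wordMap l), ⟪x, coroot α⟫ := by
  induction l with
  | nil =>
    have hempty : S.PiSet (S.wordMap []) = ∅ :=
      Finset.filter_eq_empty_iff.mpr fun α hα => S.not_both α hα
    exact ⟨hx, by rw [hempty]; simp [RSD.wordMap]⟩
  | cons i l ih =>
    obtain ⟨hQ, hht⟩ := ih
    obtain ⟨hQ', hht'⟩ := hQ.sref_simple i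
    refine ⟨hQ', ?_⟩
    obtain ⟨γ, hγR, hγ⟩ := S.exists_wordMap_eq_simple l i
    have hinner : ⟪S.wordMap l x, coroot (S.simple i)⟫ = ⟪x, coroot γ⟫ := by
      rw [← hγ, ← coe_wordEquiv, inner_map_coroot_map]
    rw [wordMap_cons, hht', hinner]
    rcases S.pos_or_neg γ hγR with hpos | hneg
    · obtain ⟨hnot, heq⟩ := PiSet_cons_of_pos hγ hpos
      rw [heq, Finset.sum_insert hnot, ← hht]
      ring
    · obtain ⟨hnot, heq⟩ := PiSet_cons_of_neg hγ hneg
      rw [heq, Finset.sum_insert hnot, coroot_neg, inner_neg_right] at hht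
      linarith

lemma len_wordMap_le (l : List (Fin S.n)) : S.len (S.wordMap l) ≤ l.length :=
  Nat.sInf_le ⟨l, rfl, rfl⟩

lemma IsWeyl.exists_reduced_word {w : V → V} (hw : S.IsWeyl w) :
    ∃ l : List (Fin S.n), l.length = S.len w ∧ w = S.wordMap l := by
  obtain ⟨l, hl⟩ := hw
  exact Nat.sInf_mem (s := {k | ∃ l : List (Fin S.n), l.length = k ∧ w = S.wordMap l})
    ⟨_, l, rfl, hl⟩

lemma card_PiSet_of_reduced {l : List (Fin S.n)} (hl : l.length = S.len (S.wordMap l)) :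
    (S.PiSet (S.wordMap l)).card = l.length := by
  induction l with
  | nil =>
    rw [List.length_nil, Finset.card_eq_zero]
    exact Finset.filter_eq_empty_iff.mpr fun α hα => S.not_both α hα
  | cons i l ih =>
    have hred : l.length = S.len (S.wordMap l) := by
      refine le_antisymm ?_ (len_wordMap_le l)
      obtain ⟨t, ht, hmap⟩ := IsWeyl.exists_reduced_word ⟨l, rfl⟩
      have hcons : S.wordMap (i :: l) = S.wordMap (i :: t) := by
        ext x
        rw [wordMap_cons, wordMap_cons, hmap]
      have := len_wordMap_le (i :: t)
      rw [← hcons, ← hl, List.length_cons, List.length_cons, ht] at this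
      exact Nat.le_of_succ_le_succ this
    obtain ⟨γ, hγR, hγ⟩ := S.exists_wordMap_eq_simple l i
    rcases S.pos_or_neg γ hγR with hpos | hneg
    · obtain ⟨hnot, heq⟩ := PiSet_cons_of_pos hγ hpos
      rw [heq, Finset.card_insert_of_notMem hnot, ih hred, List.length_cons]
    · obtain ⟨t, ht, hmap⟩ := exists_word_sref_comp (l := l) hneg (S.simple_mem i)
        (by rw [wordMap_neg, hγ])
      have hcons : S.wordMap (i :: l) = S.wordMap t := funext fun x => (hmap x).symm
      have := len_wordMap_le t
      rw [← hcons, ← hl, List.length_cons] at this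
      omega

lemma IsWeyl.card_PiSet {w : V → V} (hw : S.IsWeyl w) : (S.PiSet w).card = S.len w := by
  obtain ⟨l, hl, rfl⟩ := hw.exists_reduced_word
  rw [card_PiSet_of_reduced hl, hl]

/-- A minimal-length element sending `x` to `y` inverts no positive root orthogonal to `x`. -/
lemma IsMinWord.inner_coroot_ne_zero {x y : V} {w : V → V} (hw : S.IsMinWord x y w) {α : V}
    (hα : α ∈ S.PiSet w) : ⟪x, coroot α⟫ ≠ 0 := by
  intro hzero
  obtain ⟨hW, hxy, hmin⟩ := hw
  obtain ⟨l, hl, rfl⟩ := hW.exists_reduced_word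
  obtain ⟨hpos, hneg⟩ := mem_PiSet.mp hα
  obtain ⟨t, ht, hmap⟩ := exists_word_sref_comp hpos hneg (neg_neg _).symm
  have hfix : S.wordMap t x = y := by
    rw [hmap, sref_eq_sub_coroot, coroot_neg, inner_neg_right, ← coe_wordEquiv,
      inner_map_coroot_map, hzero, coe_wordEquiv, hxy]
    simp
  have := (hmin _ ⟨t, rfl⟩ hfix).trans (len_wordMap_le t)
  omega

end RSD

/-- For every `λ ∈ Q`: `ht(λ₊) − ht(λ) = Σ_{α ∈ Π(w_λ)} (λ₊, α^∨)`;
moreover `(λ₊, α^∨) ≥ 1` for every `α ∈ Π(w_λ)`, and consequently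
`D_λ = ht(λ₊) − ht(λ) − ℓ(w_λ) = Σ_{α ∈ Π(w_λ)} ((λ₊, α^∨) − 1)` is a nonnegative integer. -/
theorem height_difference_eq_sum_over_inversions
    {V : Type*} [NormedAddCommGroup V] [InnerProductSpace ℝ V]
    (S : RSD V) (lam : V) (hlam : S.inQ lam)
    (lamp : V) (hdom : S.Dominant lamp) (horb : S.sameOrbit lam lamp)
    (w : V → V) (hw : S.IsMinWord lamp lam w) :
    ((S.htZ lamp - S.htZ lam : ℤ) : ℝ) = ∑ α ∈ S.PiSet w, ⟪lamp, coroot α⟫ ∧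
    (∀ α ∈ S.PiSet w, 1 ≤ ⟪lamp, coroot α⟫) ∧
    ((S.htZ lamp - S.htZ lam - (S.len w : ℤ) : ℤ) : ℝ)
        = ∑ α ∈ S.PiSet w, (⟪lamp, coroot α⟫ - 1) ∧
    0 ≤ S.htZ lamp - S.htZ lam - (S.len w : ℤ) := by
  have hQ : S.inQ lamp := by
    obtain ⟨_, ⟨l, rfl⟩, rfl⟩ := horb
    exact (hlam.wordMap l).1
  have hsum : ((S.htZ lamp - S.htZ lam : ℤ) : ℝ) = ∑ α ∈ S.PiSet w, ⟪lamp, coroot α⟫ := by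
    obtain ⟨⟨l, rfl⟩, rfl, -⟩ := hw
    exact_mod_cast (hQ.wordMap l).2
  have hone : ∀ α ∈ S.PiSet w, 1 ≤ ⟪lamp, coroot α⟫ := by
    intro α hα
    have hpos := (RSD.mem_PiSet.mp hα).1
    have hlt := (hdom.inner_coroot_nonneg hpos).lt_of_ne' (hw.inner_coroot_ne_zero hα)
    obtain ⟨k, hk⟩ := hQ.exists_inner_coroot_eq (S.pos_sub hpos)
    rw [hk] at hlt ⊢
    exact_mod_cast hlt
  have hdiff : ((S.htZ lamp - S.htZ lam - (S.len w : ℤ) : ℤ) : ℝ)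
      = ∑ α ∈ S.PiSet w, (⟪lamp, coroot α⟫ - 1) := by
    rw [Int.cast_sub, hsum, Finset.sum_sub_distrib, ← hw.1.card_PiSet]
    simp
  refine ⟨hsum, hone, hdiff, ?_⟩
  rw [← Int.cast_nonneg_iff (R := ℝ), hdiff]
  exact Finset.sum_nonneg fun α hα => sub_nonneg.mpr (hone α hα)

end
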